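/- arXiv:2101.02791 — 3 statements merged into one kernel-verified Lean document; each statement's English description precedes it below -/
import Mathlib

section
/- Let (L, R) be a modality in a topos E. Then both classes L and R are local: they are closed under base change, and if {g_i : A_i → B} is a surjective family such that the base change of a map f : X → B along each g_i belongs to the class, then f itself belongs to the class. -/
/-!
STATEMENT 11: for a modality (L, R) in a topos, both classes L and R are local: closed under base change and descending along surjective families.
-/

open CategoryTheory CategoryTheory.Limits

universe w v u

namespace Paper

variable {E : Type u} [Category.{v} E]

/-- `u` is left orthogonal to `f`: every commutative square from `u` to `f` admits a
unique diagonal filler. -/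
def Orth {A B X Y : E} (u : A ⟶ B) (f : X ⟶ Y) : Prop :=
  ∀ (x : A ⟶ X) (y : B ⟶ Y), x ≫ f = u ≫ y → ∃! d : B ⟶ X, u ≫ d = x ∧ d ≫ f = y

/-- A factorization system `(L, R)`: two replete classes of maps with `L` orthogonal to
`R`, such that every map factors as a map in `L` followed by a map in `R`. -/
structure FactorizationSystem (E : Type u) [Category.{v} E] where
  /-- the left class -/
  L : MorphismProperty E
  /-- the right class -/
  R : MorphismProperty E
  replete_L : ∀ ⦃X Y X' Y' : E⦄ (f : X ⟶ Y) (f' : X' ⟶ Y'),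
    (Arrow.mk f ≅ Arrow.mk f') → L f → L f'
  replete_R : ∀ ⦃X Y X' Y' : E⦄ (f : X ⟶ Y) (f' : X' ⟶ Y'),
    (Arrow.mk f ≅ Arrow.mk f') → R f → R f'
  orth : ∀ ⦃A B X Y : E⦄ (u : A ⟶ B) (f : X ⟶ Y), L u → R f → Orth u f
  fac : ∀ ⦃X Y : E⦄ (f : X ⟶ Y), ∃ (Z : E) (l : X ⟶ Z) (r : Z ⟶ Y),
    L l ∧ R r ∧ l ≫ r = f

/-- `P` is stable under base change: any pullback of a map in `P` is in `P`. -/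
def StableUnderBaseChange' (P : MorphismProperty E) : Prop :=
  ∀ ⦃W X Y Z : E⦄ (fst : W ⟶ X) (snd : W ⟶ Y) (f : X ⟶ Z) (g : Y ⟶ Z),
    IsPullback fst snd f g → P f → P snd

theorem isIso_left_of_orth {X Y Z : E} (l : X ⟶ Z) (r : Z ⟶ Y) (h : Orth l r)
    (h' : Orth l (l ≫ r)) : IsIso l := by
  obtain ⟨d, ⟨h1, h2⟩, -⟩ := h' (𝟙 X) r (by simp)
  refine ⟨d, h1, ?_⟩
  exact (h l r rfl).unique ⟨by rw [← Category.assoc, h1, Category.id_comp],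
    by rw [Category.assoc, h2]⟩ ⟨by simp, by simp⟩

theorem isIso_right_of_orth {X Y Z : E} (l : X ⟶ Z) (r : Z ⟶ Y) (h : Orth l r)
    (h' : Orth (l ≫ r) r) : IsIso r := by
  obtain ⟨d, ⟨h1, h2⟩, -⟩ := h' l (𝟙 Y) (by simp)
  refine ⟨d, ?_, h2⟩
  exact (h l r rfl).unique ⟨by rw [← Category.assoc, h1],
    by rw [Category.assoc, h2, Category.comp_id]⟩ ⟨by simp, by simp⟩

theorem L_of_isIso (S : FactorizationSystem E) {X Y Z : E} (l : X ⟶ Z) (r : Z ⟶ Y)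
    (hl : S.L l) [IsIso r] : S.L (l ≫ r) :=
  S.replete_L l _ (Arrow.isoMk (Iso.refl _) (asIso r) (by simp)) hl

theorem R_of_isIso (S : FactorizationSystem E) {X Y Z : E} (l : X ⟶ Z) (r : Z ⟶ Y)
    (hr : S.R r) [IsIso l] : S.R (l ≫ r) :=
  S.replete_R r _ (Arrow.isoMk (asIso l).symm (Iso.refl _) (by simp)) hr

theorem R_stable (S : FactorizationSystem E) : StableUnderBaseChange' S.R := by
  intro W X Y Z fst snd f g sq hf
  have key : ∀ ⦃A B : E⦄ (u : A ⟶ B), S.L u → Orth u snd := by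
    intro A B u hu x y hxy
    obtain ⟨d, ⟨h1, h2⟩, hd⟩ := S.orth u f hu hf (x ≫ fst) (y ≫ g) (by
      rw [Category.assoc, sq.w, ← Category.assoc, hxy, Category.assoc])
    refine ⟨sq.lift d y h2, ⟨?_, by simp⟩, ?_⟩
    · apply sq.hom_ext
      · simp [h1]
      · simp [hxy]
    · rintro e ⟨he1, he2⟩
      apply sq.hom_ext
      · rw [sq.lift_fst]
        apply hd
        exact ⟨by rw [← Category.assoc, he1], by rw [Category.assoc, sq.w, ← Category.assoc, he2]⟩
      · rw [sq.lift_snd, he2]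
  obtain ⟨V, l, r, hl, hr, rfl⟩ := S.fac snd
  have := isIso_left_of_orth l r (S.orth l r hl hr) (key l hl)
  exact R_of_isIso S l r hr

end Paper

namespace Paper

universe v₂ u₂
variable {E : Type u} [Category.{v} E]

variable [HasFiniteLimits E]

/-- A family of maps `g i : A i ⟶ B` is surjective: the base change functors along the
`g i` are jointly conservative. -/
def SurjFamily {ι : Type w} {A : ι → E} {B : E} (g : ∀ i, A i ⟶ B) : Prop :=
  ∀ ⦃X Y : Over B⦄ (φ : X ⟶ Y),
    (∀ i, IsIso ((Over.pullback (g i)).map φ)) → IsIso φ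

/-- A class of maps is local: it is closed under base change and descends along
surjective families. -/
def IsLocalClass (P : MorphismProperty E) : Prop :=
  StableUnderBaseChange' P ∧
  ∀ ⦃ι : Type w⦄ {A : ι → E} {B : E} (g : ∀ i, A i ⟶ B), SurjFamily g →
    ∀ ⦃X : E⦄ (f : X ⟶ B), (∀ i, P (pullback.snd f (g i))) → P f

theorem isPullback_map {A B X Y : E} (g : A ⟶ B) (l : X ⟶ Y) (r : Y ⟶ B) :
    IsPullback (pullback.fst (l ≫ r) g)
      (pullback.lift (pullback.fst (l ≫ r) g ≫ l) (pullback.snd (l ≫ r) g)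
        (by simp [pullback.condition])) l (pullback.fst r g) := by
  refine IsPullback.of_bot (v₂₁ := pullback.snd r g) (v₂₂ := r) (h₃₁ := g) ?_ ?_
    (IsPullback.of_hasPullback r g)
  · rw [pullback.lift_snd]
    exact IsPullback.of_hasPullback (l ≫ r) g
  · rw [pullback.lift_fst]

/-- for a modality `(L, R)` in a topos, both `L` and `R` are local
classes. -/
theorem modality_classes_local [HasColimits E] (S : FactorizationSystem E)
    (hmod : StableUnderBaseChange' S.L) :
    IsLocalClass.{w} S.L ∧ IsLocalClass.{w} S.R := by
  have hR := R_stable S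
  refine ⟨⟨hmod, ?_⟩, ⟨hR, ?_⟩⟩
  · intro ι A B g hg X f hf
    obtain ⟨Z, l, r, hl, hr, rfl⟩ := S.fac f
    have : IsIso r := by
      have h := hg (X := Over.mk r) (Y := Over.mk (𝟙 B)) (Over.homMk r (by simp)) (fun i => by
        have hl' := hmod _ _ _ _ (isPullback_map (g i) l r) hl
        have hr' := hR _ _ _ _ (IsPullback.of_hasPullback r (g i)) hr
        have : IsIso (pullback.snd r (g i)) :=
          isIso_right_of_orth _ _ (S.orth _ _ hl' hr') (S.orth _ _ (by rw [pullback.lift_snd]; exact hf i) hr')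
        have : IsIso ((Over.forget _).map ((Over.pullback (g i)).map
            (Over.homMk r (by simp) : Over.mk r ⟶ Over.mk (𝟙 B)))) := by
          have e : (Over.forget _).map ((Over.pullback (g i)).map
            (Over.homMk r (by simp) : Over.mk r ⟶ Over.mk (𝟙 B))) ≫ pullback.snd (𝟙 B) (g i)
              = pullback.snd r (g i) := by
            exact pullback.lift_snd _ _ _
          have : IsIso ((Over.forget _).map ((Over.pullback (g i)).map
            (Over.homMk r (by simp) : Over.mk r ⟶ Over.mk (𝟙 B))) ≫ pullback.snd (𝟙 B) (g i)) := by
            rw [e]; assumption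
          have h3 : IsIso (pullback.snd (𝟙 B) (g i)) := (IsPullback.of_hasPullback (𝟙 B) (g i)).isIso_snd_of_isIso
          exact @IsIso.of_isIso_comp_right _ _ _ _ _ _ _ h3 this
        exact isIso_of_reflects_iso _ (Over.forget _))
      exact inferInstanceAs (IsIso ((Over.forget B).map
        (Over.homMk r (by simp) : Over.mk r ⟶ Over.mk (𝟙 B))))
    exact L_of_isIso S l r hl
  · intro ι A B g hg X f hf
    obtain ⟨Z, l, r, hl, hr, rfl⟩ := S.fac f
    have : IsIso l := by
      have h := hg (X := Over.mk (l ≫ r)) (Y := Over.mk r) (Over.homMk l (by simp)) (fun i => by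
        have hl' := hmod _ _ _ _ (isPullback_map (g i) l r) hl
        have hr' := hR _ _ _ _ (IsPullback.of_hasPullback r (g i)) hr
        have hI := isIso_left_of_orth _ _ (S.orth _ _ hl' hr')
            (S.orth _ _ hl' (by rw [pullback.lift_snd]; exact hf i))
        have : IsIso ((Over.forget _).map ((Over.pullback (g i)).map
            (Over.homMk l (by simp) : Over.mk (l ≫ r) ⟶ Over.mk r))) := hI
        exact isIso_of_reflects_iso _ (Over.forget _))
      exact inferInstanceAs (IsIso ((Over.forget B).map
        (Over.homMk l (by simp) : Over.mk (l ≫ r) ⟶ Over.mk r)))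
    exact R_of_isIso S l r hr

end Paper
end

section
/- Let (L, R) be a modality in a category E with finite limits. The following are equivalent: (1) L is closed under finite limits in the arrow category; (2) L has the 3-for-2 property; (3) Δ(u) ∈ L for every u ∈ L. -/
/-!
STATEMENT 17: for a modality, closure of L under finite limits, 3-for-2 for L, and closure of L under diagonals are equivalent.
-/

open CategoryTheory CategoryTheory.Limits

universe w v u

namespace Paper

universe v₂ u₂
variable {E : Type u} [Category.{v} E]

/-- The full subcategory of the arrow category spanned by `P` is closed under finite
limits. -/
def ClosedUnderFiniteLimitsArrow (P : MorphismProperty E) : Prop :=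
  ∀ (J : Type) [SmallCategory J] [FinCategory J] (D : J ⥤ Arrow E) (c : Cone D),
    IsLimit c → (∀ j, P (D.obj j).hom) → P c.pt.hom

/-- The 3-for-2 property: in a commutative triangle, if any two of the maps belong to
`P` then so does the third. -/
def ThreeForTwo (P : MorphismProperty E) : Prop :=
  (∀ ⦃X Y Z : E⦄ (f : X ⟶ Y) (g : Y ⟶ Z), P f → P g → P (f ≫ g)) ∧
  (∀ ⦃X Y Z : E⦄ (f : X ⟶ Y) (g : Y ⟶ Z), P f → P (f ≫ g) → P g) ∧
  (∀ ⦃X Y Z : E⦄ (f : X ⟶ Y) (g : Y ⟶ Z), P g → P (f ≫ g) → P f)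

section Helpers

lemma mem_L_of_orth (S : FactorizationSystem E) {A B : E} (u : A ⟶ B)
    (h : ∀ ⦃X Y : E⦄ (r : X ⟶ Y), S.R r → Orth u r) : S.L u := by
  obtain ⟨Z, l, r, hl, hr, e⟩ := S.fac u
  obtain ⟨d, ⟨hd1, hd2⟩, -⟩ := h r hr l (𝟙 _) (by simp [e])
  have hrd : r ≫ d = 𝟙 Z :=
    (S.orth l r hl hr l r rfl).unique ⟨by rw [← Category.assoc, e, hd1], by simp [hd2]⟩
      ⟨by simp, by simp⟩
  refine S.replete_L l u (Arrow.isoMk (Iso.refl _) ⟨r, d, hrd, hd2⟩ (by simp [e])) hl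

lemma L_of_isIso_s17 (S : FactorizationSystem E) {A B : E} (u : A ⟶ B) [IsIso u] : S.L u := by
  apply mem_L_of_orth
  intro X Y r _ x y e
  refine ⟨inv u ≫ x, ⟨by simp, by simp [e]⟩, ?_⟩
  rintro d ⟨h1, -⟩
  simp [← h1]

lemma L_comp (S : FactorizationSystem E) {A B C : E} (f : A ⟶ B) (g : B ⟶ C)
    (hf : S.L f) (hg : S.L g) : S.L (f ≫ g) := by
  apply mem_L_of_orth
  intro X Y r hr x y e
  obtain ⟨d, ⟨h1, h2⟩, hu⟩ := S.orth f r hf hr x (g ≫ y) (by simpa using e)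
  obtain ⟨d', ⟨h1', h2'⟩, hu'⟩ := S.orth g r hg hr d y h2
  refine ⟨d', ⟨by simp [h1', h1], h2'⟩, ?_⟩
  rintro k ⟨k1, k2⟩
  exact hu' k ⟨hu _ ⟨by simpa using k1, by simp [k2]⟩, k2⟩

lemma L_cancel (S : FactorizationSystem E) {A B C : E} (f : A ⟶ B) (g : B ⟶ C)
    (hf : S.L f) (hfg : S.L (f ≫ g)) : S.L g := by
  apply mem_L_of_orth
  intro X Y r hr x y e
  obtain ⟨d, ⟨h1, h2⟩, hu⟩ := S.orth (f ≫ g) r hfg hr (f ≫ x) y (by simp [e])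
  refine ⟨d, ⟨?_, h2⟩, ?_⟩
  · exact (S.orth f r hf hr (f ≫ x) (g ≫ y) (by simp [e])).unique
      ⟨by simpa using h1, by simp [h2]⟩ ⟨rfl, e⟩
  · rintro k ⟨k1, k2⟩
    exact hu k ⟨by simp [k1], k2⟩

lemma isPullback_arrow {W X Y Z : Arrow E} {a : W ⟶ X} {b : W ⟶ Y} {c : X ⟶ Z} {d : Y ⟶ Z}
    (h1 : IsPullback a.left b.left c.left d.left)
    (h2 : IsPullback a.right b.right c.right d.right) : IsPullback a b c d := by
  have sq : a ≫ c = b ≫ d := by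
    ext
    · exact h1.w
    · exact h2.w
  have e1 (s : PullbackCone c d) : s.fst.left ≫ c.left = s.snd.left ≫ d.left :=
    congrArg Arrow.Hom.left s.condition
  have e2 (s : PullbackCone c d) : s.fst.right ≫ c.right = s.snd.right ≫ d.right :=
    congrArg Arrow.Hom.right s.condition
  refine ⟨⟨sq⟩, ⟨PullbackCone.IsLimit.mk _
    (fun s => Arrow.homMk
      (h1.lift s.fst.left s.snd.left (e1 s))
      (h2.lift s.fst.right s.snd.right (e2 s)) ?_)
    ?_ ?_ ?_⟩⟩
  · apply h2.hom_ext
    · have w1 : a.left ≫ X.hom = W.hom ≫ a.right := Arrow.w a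
      have w2 : s.fst.left ≫ X.hom = s.pt.hom ≫ s.fst.right := Arrow.w s.fst
      rw [Category.assoc, Category.assoc, ← w1]
      erw [h2.lift_fst, h1.lift_fst_assoc]
      exact w2
    · have w1 : b.left ≫ Y.hom = W.hom ≫ b.right := Arrow.w b
      have w2 : s.snd.left ≫ Y.hom = s.pt.hom ≫ s.snd.right := Arrow.w s.snd
      rw [Category.assoc, Category.assoc, ← w1]
      erw [h2.lift_snd, h1.lift_snd_assoc]
      exact w2
  · intro s
    ext
    · exact h1.lift_fst _ _ (e1 s)
    · exact h2.lift_fst _ _ (e2 s)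
  · intro s
    ext
    · exact h1.lift_snd _ _ (e1 s)
    · exact h2.lift_snd _ _ (e2 s)
  · intro s m hm1 hm2
    ext
    · apply h1.hom_ext
      · exact (congrArg Arrow.Hom.left hm1).trans (h1.lift_fst _ _ (e1 s)).symm
      · exact (congrArg Arrow.Hom.left hm2).trans (h1.lift_snd _ _ (e1 s)).symm
    · apply h2.hom_ext
      · exact (congrArg Arrow.Hom.right hm1).trans (h2.lift_fst _ _ (e2 s)).symm
      · exact (congrArg Arrow.Hom.right hm2).trans (h2.lift_snd _ _ (e2 s)).symm

lemma diag_of_closed [HasFiniteLimits E] (P : MorphismProperty E)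
    (hid : ∀ X : E, P (𝟙 X))
    (h : ClosedUnderFiniteLimitsArrow P) {A B : E} (u : A ⟶ B) (hu : P u) :
    P (pullback.diagonal u) := by
  let k : Arrow.mk (𝟙 A) ⟶ Arrow.mk u := Arrow.homMk (𝟙 A) u (by simp)
  let a : Arrow.mk (pullback.diagonal u) ⟶ Arrow.mk (𝟙 A) :=
    Arrow.homMk (𝟙 A) (pullback.fst u u) (by simp)
  let b : Arrow.mk (pullback.diagonal u) ⟶ Arrow.mk (𝟙 A) :=
    Arrow.homMk (𝟙 A) (pullback.snd u u) (by simp)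
  have sq : IsPullback a b k k :=
    isPullback_arrow (IsPullback.of_id_fst (f := 𝟙 A)) (IsPullback.of_hasPullback u u)
  refine h WalkingCospan _ _ sq.isLimit ?_
  rintro (_ | _ | _)
  · exact hu
  · exact hid A
  · exact hid A

lemma map_mem [HasFiniteLimits E] (P : MorphismProperty E)
    [P.IsStableUnderBaseChange] [P.IsMultiplicative]
    (hd : ∀ ⦃A B : E⦄ (u : A ⟶ B), P u → P (pullback.diagonal u))
    {X Y Z X' Y' Z' : E} (f : X ⟶ Z) (g : Y ⟶ Z) (f' : X' ⟶ Z') (g' : Y' ⟶ Z')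
    (x : X ⟶ X') (y : Y ⟶ Y') (z : Z ⟶ Z') (hf : f ≫ z = x ≫ f') (hg : g ≫ z = y ≫ g')
    (hx : P x) (hy : P y) (hz : P z) : P (pullback.map f g f' g' x y z hf hg) := by
  have : pullback.map f g f' g' x y z hf hg =
      pullback.map f g (f ≫ z) (g ≫ z) (𝟙 _) (𝟙 _) z
        (Category.id_comp _).symm (Category.id_comp _).symm ≫
      pullback.map (f ≫ z) (g ≫ z) f' g' x y (𝟙 _)
        ((Category.comp_id _).trans hf) ((Category.comp_id _).trans hg) := by
    apply pullback.hom_ext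
    · rw [Category.assoc]
      erw [pullback.lift_fst, pullback.lift_fst, pullback.lift_fst_assoc, Category.comp_id]
    · rw [Category.assoc]
      erw [pullback.lift_snd, pullback.lift_snd, pullback.lift_snd_assoc, Category.comp_id]
  rw [this]
  apply P.comp_mem
  · exact P.of_isPullback (pullback_map_diagonal_isPullback f g z) (hd _ hz)
  · exact P.pullbackMap hx hy hf hg

lemma pullback_mem [HasFiniteLimits E] (P : MorphismProperty E)
    [P.IsStableUnderBaseChange] [P.IsMultiplicative]
    (hd : ∀ ⦃A B : E⦄ (u : A ⟶ B), P u → P (pullback.diagonal u))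
    {W X Y Z : Arrow E} {a : W ⟶ X} {b : W ⟶ Y} {c : X ⟶ Z} {d : Y ⟶ Z}
    (h : IsPullback a b c d) (hX : P X.hom) (hY : P Y.hom) (hZ : P Z.hom) : P W.hom := by
  have hc : c.left ≫ Z.hom = X.hom ≫ c.right := Arrow.w c
  have hd' : d.left ≫ Z.hom = Y.hom ≫ d.right := Arrow.w d
  let m := pullback.map c.left d.left c.right d.right X.hom Y.hom Z.hom hc hd'
  have hm : P m := map_mem P hd _ _ _ _ _ _ _ hc hd' hX hY hZ
  let p : Arrow.mk m ⟶ X :=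
    Arrow.homMk (pullback.fst _ _) (pullback.fst _ _) (pullback.lift_fst _ _ _).symm
  let q : Arrow.mk m ⟶ Y :=
    Arrow.homMk (pullback.snd _ _) (pullback.snd _ _) (pullback.lift_snd _ _ _).symm
  have sq : IsPullback p q c d :=
    isPullback_arrow (IsPullback.of_hasPullback _ _) (IsPullback.of_hasPullback _ _)
  exact (P.arrow_mk_iso_iff (sq.isoIsPullback _ _ h)).1 hm

lemma closed_of_diag [HasFiniteLimits E] (P : MorphismProperty E)
    [P.IsStableUnderBaseChange] [P.IsMultiplicative]
    (hd : ∀ ⦃A B : E⦄ (u : A ⟶ B), P u → P (pullback.diagonal u)) :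
    ClosedUnderFiniteLimitsArrow P := by
  let Q : ObjectProperty (Arrow E) := fun f => P f.hom
  have : Q.IsClosedUnderIsomorphisms := ⟨fun e h => (P.arrow_mk_iso_iff e).1 h⟩
  have : Q.IsClosedUnderLimitsOfShape WalkingCospan := ⟨by
    rintro X ⟨p⟩
    have hl := (IsLimit.postcomposeHomEquiv (diagramIsoCospan p.diag) _).symm p.isLimit
    have sq := IsPullback.of_isLimit_cone hl
    exact pullback_mem P hd sq (p.prop_diag_obj _) (p.prop_diag_obj _) (p.prop_diag_obj _)⟩
  have : Q.IsClosedUnderLimitsOfShape (Discrete.{0} PEmpty) := ⟨by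
    rintro X ⟨p⟩
    have ht : IsTerminal (Arrow.mk (𝟙 (⊤_ E))) := IsTerminal.ofUniqueHom
      (fun X => Arrow.homMk (terminal.from _) (terminal.from _) (terminalIsTerminal.hom_ext _ _))
      (fun X m => by ext <;> exact terminalIsTerminal.hom_ext _ _)
    have ht' : IsTerminal X :=
      (isLimitChangeEmptyCone _ p.isLimit _ (Iso.refl _))
    exact Q.prop_of_iso (ht.uniqueUpToIso ht') (P.id_mem _)⟩
  have : HasTerminal Q.FullSubcategory := hasLimitsOfShape_of_closedUnderLimits _ _
  have : HasPullbacks Q.FullSubcategory := hasLimitsOfShape_of_closedUnderLimits _ _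
  have : PreservesFiniteLimits Q.ι :=
    preservesFiniteLimits_of_preservesTerminal_and_pullbacks _
  have : HasFiniteLimits Q.FullSubcategory := hasFiniteLimits_of_hasTerminal_and_pullbacks
  intro J _ _ D c hc h
  have := Q.isClosedUnderLimitsOfShape_of_preservesLimitsOfShape_ι J
  exact Q.prop_of_isLimit hc h

end Helpers

/-- for a modality `(L, R)` in a category with finite limits, the
following are equivalent: (1) `L` is closed under finite limits in the arrow category;
(2) `L` has the 3-for-2 property; (3) `Δ(u) ∈ L` for every `u ∈ L`. -/
theorem lex_modality_characterization [HasFiniteLimits E]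
    (S : FactorizationSystem E) (hmod : StableUnderBaseChange' S.L) :
    (ClosedUnderFiniteLimitsArrow S.L ↔ ThreeForTwo S.L) ∧
    (ThreeForTwo S.L ↔
      ∀ ⦃A B : E⦄ (u : A ⟶ B), S.L u → S.L (pullback.diagonal u)) := by
  have hbc : S.L.IsStableUnderBaseChange := ⟨fun {_ _ _ _ _ _ _ _} sq h => hmod _ _ _ _ sq h⟩
  have hmul : S.L.IsMultiplicative :=
    { id_mem := fun X => L_of_isIso_s17 S _
      comp_mem := fun f g hf hg => L_comp S f g hf hg }
  have h23 : ThreeForTwo S.L ↔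
      ∀ ⦃A B : E⦄ (u : A ⟶ B), S.L u → S.L (pullback.diagonal u) := by
    have key := MorphismProperty.hasOfPostcompProperty_iff_le_diagonal (P := S.L) (Q := S.L)
    constructor
    · intro h A B u hu
      exact key.1 ⟨fun f g hg hfg => h.2.2 f g hg hfg⟩ u hu
    · intro h
      have k := key.2 (fun A B u hu => h u hu)
      exact ⟨fun _ _ _ f g => L_comp S f g, fun _ _ _ f g => L_cancel S f g,
        fun _ _ _ f g hg hfg => k.of_postcomp f g hg hfg⟩
  refine ⟨⟨fun h => h23.2 fun A B u hu => diag_of_closed S.L S.L.id_mem h u hu,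
    fun h => closed_of_diag S.L (h23.1 h)⟩, h23⟩

end Paper
end

section
/- In a topos, a class of maps W is a congruence (saturated and closed under finite limits in the arrow category) if and only if W is strongly saturated and closed under base change, if and only if W is acyclic and closed under diagonals. -/
/-!
STATEMENT 18: characterization of congruences: congruence = strongly saturated + base change = acyclic + diagonals.
-/

open CategoryTheory CategoryTheory.Limits

universe w v u

namespace Paper

universe v₂ u₂
variable {E : Type u} [Category.{v} E]

/-- The full subcategory of the arrow category spanned by `P` is closed under (small)
colimits. -/
def ClosedUnderColimitsArrow (P : MorphismProperty E) : Prop :=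
  ∀ (J : Type v) [SmallCategory J] (D : J ⥤ Arrow E) (c : Cocone D),
    IsColimit c → (∀ j, P (D.obj j).hom) → P c.pt.hom

/-- `P` is saturated: contains the isomorphisms, closed under composition and under
colimits in the arrow category. -/
def IsSaturated (P : MorphismProperty E) : Prop :=
  (∀ ⦃X Y : E⦄ (f : X ⟶ Y), IsIso f → P f) ∧
  (∀ ⦃X Y Z : E⦄ (f : X ⟶ Y) (g : Y ⟶ Z), P f → P g → P (f ≫ g)) ∧
  ClosedUnderColimitsArrow P

/-- `P` is strongly saturated: saturated with the 3-for-2 property. -/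
def IsStronglySaturated (P : MorphismProperty E) : Prop :=
  IsSaturated P ∧ ThreeForTwo P

/-- `P` is acyclic: saturated and closed under base change. -/
def IsAcyclic (P : MorphismProperty E) : Prop :=
  IsSaturated P ∧ StableUnderBaseChange' P

/-- `P` is closed under diagonals. -/
def DiagClosed [HasFiniteLimits E] (P : MorphismProperty E) : Prop :=
  ∀ ⦃X Y : E⦄ (u : X ⟶ Y), P u → P (pullback.diagonal u)

/-- `P` is a congruence: saturated and closed under finite limits in the arrow
category. -/
def IsCongruence (P : MorphismProperty E) : Prop :=
  IsSaturated P ∧ ClosedUnderFiniteLimitsArrow P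

theorem congr_comp_left {A B C D : Arrow E} {p : A ⟶ B} {q : A ⟶ C} {f : B ⟶ D} {g : C ⟶ D}
    (h : p ≫ f = q ≫ g) : p.left ≫ f.left = q.left ≫ g.left := Arrow.hom.congr_left h

theorem congr_comp_right {A B C D : Arrow E} {p : A ⟶ B} {q : A ⟶ C} {f : B ⟶ D} {g : C ⟶ D}
    (h : p ≫ f = q ≫ g) : p.right ≫ f.right = q.right ≫ g.right := Arrow.hom.congr_right h

theorem arrow_isPullback {A B C D : Arrow E} {p : A ⟶ B} {q : A ⟶ C} {f : B ⟶ D} {g : C ⟶ D}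
    (hl : IsPullback p.left q.left f.left g.left)
    (hr : IsPullback p.right q.right f.right g.right) : IsPullback p q f g := by
  have w : p ≫ f = q ≫ g := by
    ext
    · exact hl.w
    · exact hr.w
  refine ⟨⟨w⟩, ⟨PullbackCone.IsLimit.mk w (fun s => Arrow.homMk
    (hl.lift s.fst.left s.snd.left (congr_comp_left s.condition))
    (hr.lift s.fst.right s.snd.right (congr_comp_right s.condition)) ?_) ?_ ?_ ?_⟩⟩
  · apply hr.hom_ext
    · have h1 := Arrow.w p
      have h2 := Arrow.w s.fst
      rw [Category.assoc, Category.assoc, ← h1, IsPullback.lift_fst_assoc, IsPullback.lift_fst]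
      exact h2
    · have h1 := Arrow.w q
      have h2 := Arrow.w s.snd
      rw [Category.assoc, Category.assoc, ← h1, IsPullback.lift_snd_assoc, IsPullback.lift_snd]
      exact h2
  · intro s
    ext
    · exact hl.lift_fst _ _ _
    · exact hr.lift_fst _ _ _
  · intro s
    ext
    · exact hl.lift_snd _ _ _
    · exact hr.lift_snd _ _ _
  · intro s m h1 h2
    ext
    · apply hl.hom_ext
      · exact (Arrow.hom.congr_left h1).trans (hl.lift_fst _ _ _).symm
      · exact (Arrow.hom.congr_left h2).trans (hl.lift_snd _ _ _).symm
    · apply hr.hom_ext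
      · exact (Arrow.hom.congr_right h1).trans (hr.lift_fst _ _ _).symm
      · exact (Arrow.hom.congr_right h2).trans (hr.lift_snd _ _ _).symm

theorem arrow_isPushout {A B C D : Arrow E} {p : D ⟶ B} {q : D ⟶ C} {f : B ⟶ A} {g : C ⟶ A}
    (hl : IsPushout p.left q.left f.left g.left)
    (hr : IsPushout p.right q.right f.right g.right) : IsPushout p q f g := by
  have w : p ≫ f = q ≫ g := by
    ext
    · exact hl.w
    · exact hr.w
  refine ⟨⟨w⟩, ⟨PushoutCocone.IsColimit.mk w (fun s => Arrow.homMk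
    (hl.desc s.inl.left s.inr.left (congr_comp_left s.condition))
    (hr.desc s.inl.right s.inr.right (congr_comp_right s.condition)) ?_) ?_ ?_ ?_⟩⟩
  · apply hl.hom_ext
    · have h1 := Arrow.w f
      have h2 := Arrow.w s.inl
      rw [IsPushout.inl_desc_assoc, reassoc_of% h1, IsPushout.inl_desc]
      exact h2
    · have h1 := Arrow.w g
      have h2 := Arrow.w s.inr
      rw [IsPushout.inr_desc_assoc, reassoc_of% h1, IsPushout.inr_desc]
      exact h2
  · intro s
    ext
    · exact hl.inl_desc _ _ _
    · exact hr.inl_desc _ _ _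
  · intro s
    ext
    · exact hl.inr_desc _ _ _
    · exact hr.inr_desc _ _ _
  · intro s m h1 h2
    ext
    · apply hl.hom_ext
      · exact (Arrow.hom.congr_left h1).trans (hl.inl_desc _ _ _).symm
      · exact (Arrow.hom.congr_left h2).trans (hl.inr_desc _ _ _).symm
    · apply hr.hom_ext
      · exact (Arrow.hom.congr_right h1).trans (hr.inl_desc _ _ _).symm
      · exact (Arrow.hom.congr_right h2).trans (hr.inr_desc _ _ _).symm

/-- `W` as a property of objects of the arrow category. -/
def objProp (W : MorphismProperty E) : ObjectProperty (Arrow E) := fun a => W a.hom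

theorem mem_of_arrow_isPullback {W : MorphismProperty E} (hW : ClosedUnderFiniteLimitsArrow W)
    {A B C D : Arrow E} {p : A ⟶ B} {q : A ⟶ C} {f : B ⟶ D} {g : C ⟶ D}
    (h : IsPullback p q f g) (hB : W B.hom) (hC : W C.hom) (hD : W D.hom) : W A.hom := by
  refine hW WalkingCospan (cospan f g) h.cone h.isLimit ?_
  rintro (_ | _ | _)
  exacts [hD, hB, hC]

theorem mem_of_arrow_isPushout {W : MorphismProperty E} (hW : ClosedUnderColimitsArrow W)
    {A B C D : Arrow E} {p : D ⟶ B} {q : D ⟶ C} {f : B ⟶ A} {g : C ⟶ A}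
    (h : IsPushout p q f g) (hB : W B.hom) (hC : W C.hom) (hD : W D.hom) : W A.hom := by
  have : (objProp W).IsClosedUnderColimitsOfShape (ULiftHom.{v} (ULift.{v} WalkingSpan)) := by
    constructor
    rintro X ⟨c⟩
    exact hW _ c.diag (Cocone.mk X c.ι) c.isColimit c.prop_diag_obj
  have : (objProp W).IsClosedUnderColimitsOfShape WalkingSpan :=
    .of_equivalence (ULiftHomULiftCategory.equiv.{v, v} WalkingSpan).symm
  refine (objProp W).prop_of_isColimit h.isColimit ?_
  rintro (_ | _ | _)
  exacts [hD, hB, hC]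

theorem congr_baseChange {W : MorphismProperty E} (hW : IsCongruence W) :
    StableUnderBaseChange' W := by
  intro P X Y Z fst snd f g h hf
  have hr : IsPullback g (𝟙 Y) (𝟙 Z) g := IsPullback.of_vert_isIso ⟨by simp⟩
  have := mem_of_arrow_isPullback hW.2
    (A := Arrow.mk snd) (B := Arrow.mk f) (C := Arrow.mk (𝟙 Y)) (D := Arrow.mk (𝟙 Z))
    (p := Arrow.homMk fst g h.w) (q := Arrow.homMk snd (𝟙 Y) rfl)
    (f := Arrow.homMk f (𝟙 Z) rfl) (g := Arrow.homMk g g (by simp))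
    (arrow_isPullback h hr)
  exact this hf (hW.1.1 (𝟙 _) inferInstance) (hW.1.1 (𝟙 _) inferInstance)

theorem congr_diag [HasFiniteLimits E] {W : MorphismProperty E} (hW : IsCongruence W) :
    DiagClosed W := by
  intro X Y u hu
  have hl : IsPullback (𝟙 X) (𝟙 X) (𝟙 X) (𝟙 X) := IsPullback.of_vert_isIso ⟨by simp⟩
  have := mem_of_arrow_isPullback hW.2
    (A := Arrow.mk (pullback.diagonal u)) (B := Arrow.mk (𝟙 X)) (C := Arrow.mk (𝟙 X))
    (D := Arrow.mk u)
    (p := Arrow.homMk (𝟙 X) (pullback.fst u u) (by simp))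
    (q := Arrow.homMk (𝟙 X) (pullback.snd u u) (by simp))
    (f := Arrow.homMk (𝟙 X) u (by simp)) (g := Arrow.homMk (𝟙 X) u (by simp))
    (arrow_isPullback hl (IsPullback.of_hasPullback u u))
  exact this (hW.1.1 (𝟙 _) inferInstance) (hW.1.1 (𝟙 _) inferInstance) hu

theorem congr_threeForTwo {W : MorphismProperty E} (hW : IsCongruence W) :
    ThreeForTwo W := by
  refine ⟨hW.1.2.1, ?_, ?_⟩
  · intro X Y Z f g hf hfg
    have hl : IsPushout (𝟙 X) f f (𝟙 Y) := IsPushout.of_horiz_isIso ⟨by simp⟩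
    have hr : IsPushout g (𝟙 Y) (𝟙 Z) g := IsPushout.of_vert_isIso ⟨by simp⟩
    have := mem_of_arrow_isPushout hW.1.2.2
      (D := Arrow.mk f) (B := Arrow.mk (f ≫ g)) (C := Arrow.mk (𝟙 Y)) (A := Arrow.mk g)
      (p := Arrow.homMk (𝟙 X) g (by simp)) (q := Arrow.homMk f (𝟙 Y) (by simp))
      (f := Arrow.homMk f (𝟙 Z) (by simp)) (g := Arrow.homMk (𝟙 Y) g (by simp))
      (arrow_isPushout hl hr)
    exact this hfg (hW.1.1 (𝟙 _) inferInstance) hf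
  · intro X Y Z f g hg hfg
    have hl : IsPullback (𝟙 X) f f (𝟙 Y) := IsPullback.of_horiz_isIso ⟨by simp⟩
    have hr : IsPullback g (𝟙 Y) (𝟙 Z) g := IsPullback.of_vert_isIso ⟨by simp⟩
    have := mem_of_arrow_isPullback hW.2
      (A := Arrow.mk f) (B := Arrow.mk (f ≫ g)) (C := Arrow.mk (𝟙 Y)) (D := Arrow.mk g)
      (p := Arrow.homMk (𝟙 X) g (by simp)) (q := Arrow.homMk f (𝟙 Y) (by simp))
      (f := Arrow.homMk f (𝟙 Z) (by simp)) (g := Arrow.homMk (𝟙 Y) g (by simp))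
      (arrow_isPullback hl hr)
    exact this hfg (hW.1.1 (𝟙 _) inferInstance) hg

theorem diag_of_threeForTwo [HasFiniteLimits E] {W : MorphismProperty E}
    (hW : IsStronglySaturated W) (hb : StableUnderBaseChange' W) : DiagClosed W := by
  intro X Y u hu
  refine hW.2.2.2 _ (pullback.snd u u) (hb _ _ _ _ (IsPullback.of_hasPullback u u) hu) ?_
  exact hW.1.1 _ (by rw [pullback.diagonal_snd]; infer_instance)

theorem mem_of_isPullback [HasFiniteLimits E] {W : MorphismProperty E} (hW : IsAcyclic W)
    (hd : DiagClosed W) {A B C D : Arrow E} {p : A ⟶ B} {q : A ⟶ C} {f : B ⟶ D} {g : C ⟶ D}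
    (hl : IsPullback p.left q.left f.left g.left)
    (hr : IsPullback p.right q.right f.right g.right)
    (hB : W B.hom) (hC : W C.hom) (hD : W D.hom) : W A.hom := by
  obtain ⟨⟨hi, hc, -⟩, hb⟩ := hW
  have hresp : W.RespectsIso := MorphismProperty.RespectsIso.mk _
    (fun e f hf => hc _ _ (hi _ inferInstance) hf) (fun e f hf => hc _ _ hf (hi _ inferInstance))
  have : W.IsStableUnderBaseChange := ⟨fun sq h => hb _ _ _ _ sq h⟩
  have : W.IsStableUnderComposition := ⟨fun f g hf hg => hc f g hf hg⟩
  have h1 := hb _ _ _ _ (pullback_map_diagonal_isPullback f.left g.left D.hom) (hd _ hD)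
  have e1 : f.left ≫ D.hom = B.hom ≫ f.right := Arrow.w f
  have e2 : g.left ≫ D.hom = C.hom ≫ g.right := Arrow.w g
  have h2 := MorphismProperty.pullbackMap (P := W) (i₁ := B.hom) (i₂ := C.hom) hB hC e1 e2
  have h3 := hc _ _ (hc _ _ (hi hl.isoPullback.hom inferInstance) h1)
    (hc _ _ h2 (hi hr.isoPullback.inv inferInstance))
  convert h3
  have hp : p.left ≫ B.hom = A.hom ≫ p.right := Arrow.w p
  have hq : q.left ≫ C.hom = A.hom ≫ q.right := Arrow.w q
  apply hr.hom_ext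
  · rw [← hp]
    simp only [Category.assoc, IsPullback.isoPullback_inv_fst, pullback.lift_fst,
      pullback.map, IsPullback.isoPullback_hom_fst_assoc, pullback.lift_fst_assoc, Category.comp_id,
      Category.id_comp]
  · rw [← hq]
    simp only [Category.assoc, IsPullback.isoPullback_inv_snd, pullback.lift_snd,
      pullback.map, IsPullback.isoPullback_hom_snd_assoc, pullback.lift_snd_assoc, Category.comp_id,
      Category.id_comp]

theorem respIso {W : MorphismProperty E} (hW : IsSaturated W) {A B : Arrow E} (e : A ≅ B)
    (h : W A.hom) : W B.hom := by
  have hresp : W.RespectsIso := MorphismProperty.RespectsIso.mk _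
    (fun e f hf => hW.2.1 _ _ (hW.1 _ inferInstance) hf)
    (fun e f hf => hW.2.1 _ _ hf (hW.1 _ inferInstance))
  exact (W.arrow_iso_iff e).1 h

theorem mem_of_arrow_isPullback' [HasFiniteLimits E] {W : MorphismProperty E} (hW : IsAcyclic W)
    (hd : DiagClosed W) {A B C D : Arrow E} {p : A ⟶ B} {q : A ⟶ C} {f : B ⟶ D} {g : C ⟶ D}
    (h : IsPullback p q f g) (hB : W B.hom) (hC : W C.hom) (hD : W D.hom) : W A.hom := by
  let m := pullback.map f.left g.left f.right g.right B.hom C.hom D.hom (Arrow.w f) (Arrow.w g)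
  let p' : Arrow.mk m ⟶ B := Arrow.homMk (pullback.fst _ _) (pullback.fst _ _)
    (pullback.lift_fst _ _ _).symm
  let q' : Arrow.mk m ⟶ C := Arrow.homMk (pullback.snd _ _) (pullback.snd _ _)
    (pullback.lift_snd _ _ _).symm
  have hl : IsPullback p'.left q'.left f.left g.left := IsPullback.of_hasPullback _ _
  have hr : IsPullback p'.right q'.right f.right g.right := IsPullback.of_hasPullback _ _
  exact respIso hW.1 ((arrow_isPullback hl hr).isoIsPullback _ _ h)
    (mem_of_isPullback hW hd hl hr hB hC hD)

theorem finLim_of_diag [HasFiniteLimits E] {W : MorphismProperty E} (hW : IsAcyclic W)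
    (hd : DiagClosed W) : ClosedUnderFiniteLimitsArrow W := by
  have h1 : (objProp W).IsClosedUnderLimitsOfShape WalkingCospan := by
    constructor
    rintro X ⟨c⟩
    have sq := IsPullback.of_isLimit_cone c.isLimit
    exact mem_of_arrow_isPullback' hW hd sq
      (c.prop_diag_obj _) (c.prop_diag_obj _) (c.prop_diag_obj _)
  have h0 : (objProp W).IsClosedUnderLimitsOfShape (Discrete.{0} PEmpty) := by
    constructor
    rintro X ⟨c⟩
    have t : IsTerminal X :=
      ⟨fun s => c.isLimit.lift ⟨s.pt, ⟨fun j => j.as.elim, fun j => j.as.elim⟩⟩,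
      fun s j => j.as.elim, fun s m _ => c.isLimit.hom_ext fun j => j.as.elim⟩
    have t' : IsTerminal (Arrow.mk (𝟙 (⊤_ E))) := IsTerminal.ofUniqueHom
      (fun Y => Arrow.homMk (terminal.from _) (terminal.from _) (terminalIsTerminal.hom_ext _ _))
      (fun Y m => Arrow.hom_ext _ _ (terminalIsTerminal.hom_ext _ _)
        (terminalIsTerminal.hom_ext _ _))
    exact respIso hW.1 (t'.uniqueUpToIso t) (hW.1.1 (𝟙 _) inferInstance)
  have := preservesFiniteLimits_of_preservesTerminal_and_pullbacks (objProp W).ι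
  have : HasFiniteLimits (objProp W).FullSubcategory := hasFiniteLimits_of_hasTerminal_and_pullbacks
  intro J _ _ D c hc h
  let D' : J ⥤ (objProp W).FullSubcategory := (objProp W).lift D h
  have hl := isLimitOfPreserves (objProp W).ι (limit.isLimit D')
  let e : c.pt ≅ (limit D').obj := hc.conePointUniqueUpToIso hl
  have hm : W (limit D').obj.hom := (limit D').property
  exact respIso hW.1 e.symm hm

/-- in a topos, a class of maps `W` is a congruence iff it is strongly
saturated and closed under base change, iff it is acyclic and closed under
diagonals. -/
theorem congruence_characterization [HasFiniteLimits E] [HasColimits E]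
    (W : MorphismProperty E) :
    (IsCongruence W ↔ (IsStronglySaturated W ∧ StableUnderBaseChange' W)) ∧
    (IsCongruence W ↔ (IsAcyclic W ∧ DiagClosed W)) := by
  have k1 : ∀ {W : MorphismProperty E}, IsAcyclic W ∧ DiagClosed W → IsCongruence W :=
    fun h => ⟨h.1.1, finLim_of_diag h.1 h.2⟩
  refine ⟨⟨fun h => ⟨⟨h.1, congr_threeForTwo h⟩, congr_baseChange h⟩,
    fun h => k1 ⟨⟨h.1.1, h.2⟩, diag_of_threeForTwo h.1 h.2⟩⟩,
    ⟨fun h => ⟨⟨h.1, congr_baseChange h⟩, congr_diag h⟩, k1⟩⟩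

end Paper
end
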